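/- arXiv:2305.06192 — 2 statements merged into one kernel-verified Lean document; each statement's English description precedes it below -/
import Mathlib

section
/- Let d ≥ 3, let g : EuclideanSpace ℝ (Fin d) → ℝ be a Schwartz function, and let G(x) = −(Γ(d/2−1)/(4π^{d/2}))·‖x‖^{2−d}. Then for every x ∈ ℝ^d, the Newtonian potential of the Laplacian of g reproduces g: ∫_{ℝ^d} G(x−y)·(Δg)(y) dy = g(x). -/
open MeasureTheory Real
open scoped RealInnerProductSpace

noncomputable section

/-- The `j`-th canonical basis vector of `ℝ^d`. -/
def canE (d : ℕ) (j : Fin d) : EuclideanSpace ℝ (Fin d) := EuclideanSpace.single j 1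

/-- Divergence of a vector field on `ℝ^d`: `div F x = ∑ⱼ ∂Fⱼ/∂xⱼ (x)`. -/
def vdiv {d : ℕ} (F : EuclideanSpace ℝ (Fin d) → EuclideanSpace ℝ (Fin d))
    (x : EuclideanSpace ℝ (Fin d)) : ℝ :=
  ∑ j, fderiv ℝ (fun y => ⟪canE d j, F y⟫) x (canE d j)

/-- Laplacian of a scalar function on `ℝ^d` (sum of second partial derivatives). -/
def lap {d : ℕ} (f : EuclideanSpace ℝ (Fin d) → ℝ) (x : EuclideanSpace ℝ (Fin d)) : ℝ :=
  ∑ j, fderiv ℝ (fun y => fderiv ℝ f y (canE d j)) x (canE d j)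

/-- A function is a Schwartz function if it agrees with an element of the Schwartz space. -/
def IsSchwartz {d : ℕ} (f : EuclideanSpace ℝ (Fin d) → ℝ) : Prop :=
  ∃ g : SchwartzMap (EuclideanSpace ℝ (Fin d)) ℝ, ∀ x, f x = g x

/-- The fundamental solution of the Laplace equation in `ℝ^d`, `d ≥ 3`:
`G(x) = −(Γ(d/2−1)/(4 π^{d/2})) ‖x‖^{2−d}`. -/
def fundSol (d : ℕ) (x : EuclideanSpace ℝ (Fin d)) : ℝ :=
  -(Real.Gamma ((d : ℝ) / 2 - 1) / (4 * Real.pi ^ ((d : ℝ) / 2))) * ‖x‖ ^ ((2 : ℝ) - d)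

/-- The Radon transform of a scalar function: integral over the hyperplane `⟪x,ω⟫ = p`,
parametrized as `x = p•ω + y`, `y ∈ (ℝ∙ω)ᗮ`. -/
def RadonT {d : ℕ} (f : EuclideanSpace ℝ (Fin d) → ℝ) (ω : EuclideanSpace ℝ (Fin d))
    (p : ℝ) : ℝ :=
  ∫ y : ((ℝ ∙ ω)ᗮ : Submodule ℝ (EuclideanSpace ℝ (Fin d))),
    f (p • ω + (y : EuclideanSpace ℝ (Fin d)))

/-- The componentwise (vector-valued, Bochner) Radon transform of a vector field. -/
def RadonVec {d : ℕ} (F : EuclideanSpace ℝ (Fin d) → EuclideanSpace ℝ (Fin d))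
    (ω : EuclideanSpace ℝ (Fin d)) (p : ℝ) : EuclideanSpace ℝ (Fin d) :=
  ∫ y : ((ℝ ∙ ω)ᗮ : Submodule ℝ (EuclideanSpace ℝ (Fin d))),
    F (p • ω + (y : EuclideanSpace ℝ (Fin d)))

/-- The transversal Radon transform `[D^⊥F](ω,p)`. -/
def Dperp {d : ℕ} (F : EuclideanSpace ℝ (Fin d) → EuclideanSpace ℝ (Fin d))
    (ω : EuclideanSpace ℝ (Fin d)) (p : ℝ) : ℝ :=
  RadonT (fun x => ⟪ω, F x⟫) ω p

/-- The longitudinal Radon transform `[D_θ^∥F](ω,p)` for a direction `θ` orthogonal to `ω`. -/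
def Dlong {d : ℕ} (F : EuclideanSpace ℝ (Fin d) → EuclideanSpace ℝ (Fin d))
    (ω θ : EuclideanSpace ℝ (Fin d)) (p : ℝ) : ℝ :=
  RadonT (fun x => ⟪θ, F x⟫) ω p

/-- The weighted transversal Radon transform `[W_θ^⊥F](ω,p)` with linear weight `⟪θ,x⟫`. -/
def Wperp {d : ℕ} (F : EuclideanSpace ℝ (Fin d) → EuclideanSpace ℝ (Fin d))
    (ω θ : EuclideanSpace ℝ (Fin d)) (p : ℝ) : ℝ :=
  RadonT (fun x => ⟪θ, x⟫ * ⟪ω, F x⟫) ω p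

/-- The weighted longitudinal Radon transform `[W_θ^∥F](ω,p)` with linear weight `⟪θ,x⟫`. -/
def Wlong {d : ℕ} (F : EuclideanSpace ℝ (Fin d) → EuclideanSpace ℝ (Fin d))
    (ω θ : EuclideanSpace ℝ (Fin d)) (p : ℝ) : ℝ :=
  RadonT (fun x => ⟪θ, x⟫ * ⟪θ, F x⟫) ω p

open Filter Topology

abbrev EE (d : ℕ) := EuclideanSpace ℝ (Fin d)

lemma U_pos {d : ℕ} (c : ℝ) (x y : EE d) : 0 < 1 + c ^ 2 * ‖y - x‖ ^ 2 := by positivity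

lemma U_contDiff {d : ℕ} (p c : ℝ) (x : EE d) :
    ContDiff ℝ 2 (fun y : EE d => (1 + c ^ 2 * ‖y - x‖ ^ 2) ^ p) := by
  apply ContDiff.rpow_const_of_ne
  · exact contDiff_const.add (contDiff_const.mul ((contDiff_id.sub contDiff_const).norm_sq ℝ))
  · intro y; exact (U_pos c x y).ne'

lemma U_hasFDerivAt {d : ℕ} (p c : ℝ) (x y : EE d) :
    HasFDerivAt (fun y : EE d => (1 + c ^ 2 * ‖y - x‖ ^ 2) ^ p)
      ((p * (1 + c ^ 2 * ‖y - x‖ ^ 2) ^ (p - 1)) • (c ^ 2 • (2 • innerSL ℝ (y - x)))) y := by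
  have h1 : HasFDerivAt (fun y : EE d => ‖y - x‖ ^ 2) (2 • innerSL ℝ (y - x)) y := by
    have := ((hasFDerivAt_id (𝕜 := ℝ) y).sub_const x).norm_sq
    simpa using this
  have h2 := (h1.const_mul (c ^ 2)).const_add 1
  have h3 := h2.rpow_const (p := p) (Or.inl (U_pos c x y).ne')
  exact h3

lemma U_fderiv {d : ℕ} (p c : ℝ) (x y v : EE d) :
    fderiv ℝ (fun y : EE d => (1 + c ^ 2 * ‖y - x‖ ^ 2) ^ p) y v =
      2 * p * c ^ 2 * ((1 + c ^ 2 * ‖y - x‖ ^ 2) ^ (p - 1) * ⟪v, y - x⟫) := by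
  rw [(U_hasFDerivAt p c x y).fderiv, real_inner_comm]
  simp only [smul_apply, innerSL_apply_apply, smul_eq_mul, nsmul_eq_mul]
  push_cast
  ring

lemma U_fderiv2 {d : ℕ} (p c : ℝ) (x y v : EE d) :
    fderiv ℝ (fun y => fderiv ℝ (fun y : EE d => (1 + c ^ 2 * ‖y - x‖ ^ 2) ^ p) y v) y v =
      2 * p * c ^ 2 * ((1 + c ^ 2 * ‖y - x‖ ^ 2) ^ (p - 1) * ‖v‖ ^ 2 +
        2 * (p - 1) * c ^ 2 * (1 + c ^ 2 * ‖y - x‖ ^ 2) ^ (p - 1 - 1) * ⟪v, y - x⟫ ^ 2) := by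
  simp_rw [U_fderiv]
  have h1 : HasFDerivAt (fun y : EE d => ⟪v, y - x⟫) (innerSL ℝ v) y := by
    have := (innerSL ℝ v).hasFDerivAt.comp y ((hasFDerivAt_id (𝕜 := ℝ) y).sub_const x)
    simpa [Function.comp_def] using this
  have h2 := ((U_hasFDerivAt (p - 1) c x y).mul h1).const_mul (2 * p * c ^ 2)
  have h3 := congrArg (fun L => L v) h2.fderiv
  refine h3.trans ?_
  rw [← real_inner_self_eq_norm_sq v]
  simp only [smul_apply, add_apply, innerSL_apply_apply, smul_eq_mul, nsmul_eq_mul,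
    real_inner_comm v (y - x)]
  push_cast
  ring

lemma U_lap {d : ℕ} (p c : ℝ) (x y : EE d) (hp : p = (2 - d) / 2) :
    lap (fun y : EE d => (1 + c ^ 2 * ‖y - x‖ ^ 2) ^ p) y =
      (2 - d) * d * c ^ 2 * (1 + c ^ 2 * ‖y - x‖ ^ 2) ^ (-((d : ℝ) + 2) / 2) := by
  unfold lap
  simp_rw [U_fderiv2]
  rw [← Finset.mul_sum, Finset.sum_add_distrib, ← Finset.mul_sum, ← Finset.mul_sum]
  have h1 : ∑ j, ‖canE d j‖ ^ 2 = (d : ℝ) := by simp [canE]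
  have h2 : ∑ j, ⟪canE d j, y - x⟫ ^ 2 = ‖y - x‖ ^ 2 := by
    simp [canE, EuclideanSpace.norm_sq_eq, EuclideanSpace.inner_single_left]
  rw [h1, h2]
  have hU := U_pos c x y
  set U := 1 + c ^ 2 * ‖y - x‖ ^ 2 with hUd
  have h3 : U ^ (p - 1) = U ^ (p - 1 - 1) * U := by
    rw [← Real.rpow_add_one hU.ne']; ring_nf
  have h4 : -((d : ℝ) + 2) / 2 = p - 1 - 1 := by rw [hp]; ring
  have h5 : c ^ 2 * ‖y - x‖ ^ 2 = U - 1 := by rw [hUd]; ring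
  rw [h3, h4]
  have : 2 * (p - 1) * c ^ 2 * U ^ (p - 1 - 1) * ‖y - x‖ ^ 2
    = 2 * (p - 1) * U ^ (p - 1 - 1) * (U - 1) := by rw [← h5]; ring
  rw [mul_assoc, this] 
  have hd : (d : ℝ) = 2 - 2 * p := by rw [hp]; ring
  rw [hd]; ring

lemma int_bdd {d : ℕ} {f : EE d → ℝ} (hf : Continuous f) (C : ℝ) (hC : ∀ y, |f y| ≤ C)
    (h : SchwartzMap (EE d) ℝ) : Integrable (fun y => f y * h y) :=
  h.integrable.bdd_mul hf.aestronglyMeasurable (c := C) (ae_of_all _ hC)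

/-- the Schwartz function of directional derivatives -/
def dS {d : ℕ} (v : EE d) (g : SchwartzMap (EE d) ℝ) : SchwartzMap (EE d) ℝ :=
  LineDeriv.lineDerivOp v g

lemma dS_apply {d : ℕ} (v : EE d) (g : SchwartzMap (EE d) ℝ) (y : EE d) :
    dS v g y = fderiv ℝ (fun z => g z) y v := SchwartzMap.lineDerivOp_apply_eq_fderiv v g y

lemma ibp1 {d : ℕ} {f : EE d → ℝ} (v : EE d) (hf : ContDiff ℝ 1 f) (C C' : ℝ)
    (hC : ∀ y, |f y| ≤ C) (hC' : ∀ y, |fderiv ℝ f y v| ≤ C') (g : SchwartzMap (EE d) ℝ) :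
    ∫ y, f y * fderiv ℝ (fun z => g z) y v = - ∫ y, fderiv ℝ f y v * g y := by
  apply integral_mul_fderiv_eq_neg_fderiv_mul_of_integrable
  · exact int_bdd ((hf.continuous_fderiv (by norm_num)).clm_apply continuous_const) C' hC' g
  · simpa only [dS_apply] using int_bdd hf.continuous C hC (dS v g)
  · exact int_bdd hf.continuous C hC g
  · intro y _; exact hf.differentiable (by norm_num) y
  · intro y _; exact g.differentiableAt

lemma ibp2 {d : ℕ} {f : EE d → ℝ} (v : EE d) (hf : ContDiff ℝ 2 f) (C C' C'' : ℝ)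
    (hC : ∀ y, |f y| ≤ C) (hC' : ∀ y, |fderiv ℝ f y v| ≤ C')
    (hC'' : ∀ y, |fderiv ℝ (fun y => fderiv ℝ f y v) y v| ≤ C'')
    (g : SchwartzMap (EE d) ℝ) :
    ∫ y, f y * fderiv ℝ (fun y => fderiv ℝ (fun z => g z) y v) y v
      = ∫ y, fderiv ℝ (fun y => fderiv ℝ f y v) y v * g y := by
  have h1 := ibp1 v (hf.of_le (by norm_num)) C C' hC hC' (dS v g)
  have hf' : ContDiff ℝ 1 (fun y => fderiv ℝ f y v) :=
    (hf.fderiv_right (m := 1) (by norm_num)).clm_apply contDiff_const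
  have h2 := ibp1 v hf' C' C'' hC' hC'' g
  simp_rw [dS_apply] at h1
  rw [h1, h2, neg_neg]

lemma lap_schwartz {d : ℕ} (g : SchwartzMap (EE d) ℝ) (y : EE d) :
    lap (fun z => g z) y = (∑ j, dS (canE d j) (dS (canE d j) g)) y := by
  simp [lap, dS_apply]

lemma U_bounds {d : ℕ} (p c : ℝ) (hp : p ≤ 0) (hc : 0 < c) (x v : EE d) (hv : ‖v‖ = 1) :
    ∃ C C' C'' : ℝ, (∀ y, |(1 + c ^ 2 * ‖y - x‖ ^ 2) ^ p| ≤ C) ∧ 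
     (∀ y, |fderiv ℝ (fun y : EE d => (1 + c ^ 2 * ‖y - x‖ ^ 2) ^ p) y v| ≤ C') ∧
     (∀ y, |fderiv ℝ (fun y => fderiv ℝ (fun y : EE d => (1 + c ^ 2 * ‖y - x‖ ^ 2) ^ p) y v) y v| 
       ≤ C'') := by
  have key : ∀ y, |(1 + c ^ 2 * ‖y - x‖ ^ 2) ^ p| ≤ 1 ∧ |(1 + c ^ 2 * ‖y - x‖ ^ 2) ^ (p-1)| ≤ 1 ∧ 
     |(1 + c ^ 2 * ‖y - x‖ ^ 2) ^ (p-1) * (c * ⟪v, y - x⟫)| ≤ 1 ∧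
     |(1 + c ^ 2 * ‖y - x‖ ^ 2) ^ (p-1-1) * (c * ⟪v, y - x⟫) ^ 2| ≤ 1 := by
    intro y
    have hU := U_pos c x y
    have h1 : 1 ≤ 1 + c ^ 2 * ‖y - x‖ ^ 2 := by have : 0 ≤ c ^ 2 * ‖y - x‖ ^ 2 := by positivity
                                                linarith
    have h2 : (c * ⟪v, y - x⟫) ^ 2 ≤ 1 + c ^ 2 * ‖y - x‖ ^ 2 := by
      have : |⟪v, y - x⟫| ≤ ‖y - x‖ := by simpa [hv] using abs_real_inner_le_norm v (y - x)
      have := sq_le_sq' (abs_le.1 this).1 (abs_le.1 this).2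
      nlinarith [sq_nonneg c]
    set U := 1 + c ^ 2 * ‖y - x‖ ^ 2
    set t := c * ⟪v, y - x⟫
    have h3 : |t| ≤ U := by 
      have : t ^ 2 ≤ U ^ 2 := by nlinarith
      exact abs_le_of_sq_le_sq this hU.le
    have e1 : U ^ p ≤ 1 := Real.rpow_le_one_of_one_le_of_nonpos h1 hp
    have e2 : U ^ (p-1) ≤ 1 := Real.rpow_le_one_of_one_le_of_nonpos h1 (by linarith)
    have f1 : U ^ (p-1) * U = U ^ p := by rw [← Real.rpow_add_one hU.ne']; ring_nf
    have f2 : U ^ (p-1-1) * U = U ^ (p-1) := by rw [← Real.rpow_add_one hU.ne']; ring_nf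
    have p0 := Real.rpow_pos_of_pos hU p
    have p1 := Real.rpow_pos_of_pos hU (p-1)
    have p2 := Real.rpow_pos_of_pos hU (p-1-1)
    refine ⟨by rwa [abs_of_pos p0], by rwa [abs_of_pos p1], ?_, ?_⟩
    · rw [abs_mul, abs_of_pos p1]; nlinarith
    · rw [abs_mul, abs_of_pos p2, abs_of_nonneg (sq_nonneg t)]; nlinarith
  refine ⟨1, |2 * p * c|, |2 * p * c ^ 2| * (1 + |2 * (p - 1)|), fun y => (key y).1, ?_, ?_⟩
  · intro y
    obtain ⟨_, _, k3, _⟩ := key y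
    rw [U_fderiv]
    calc _ = |2 * p * c| * |(1 + c ^ 2 * ‖y - x‖ ^ 2) ^ (p-1) * (c * ⟪v, y - x⟫)| := by
            rw [← abs_mul]; ring_nf
      _ ≤ _ := mul_le_of_le_one_right (abs_nonneg _) k3
  · intro y
    obtain ⟨_, k2, _, k4⟩ := key y
    rw [U_fderiv2, hv, abs_mul]
    gcongr
    refine (abs_add_le _ _).trans (add_le_add ?_ ?_)
    · simpa using k2
    · calc _ = |2 * (p-1)| * |(1 + c ^ 2 * ‖y - x‖ ^ 2) ^ (p-1-1) * (c * ⟪v, y - x⟫)^2| := by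
            rw [← abs_mul]; ring_nf
        _ ≤ _ := mul_le_of_le_one_right (abs_nonneg _) k4

lemma green {d : ℕ} (c : ℝ) (hd : 3 ≤ d) (hc : 0 < c) (x : EE d) (g : SchwartzMap (EE d) ℝ) :
    ∫ y, (1 + c ^ 2 * ‖y - x‖ ^ 2) ^ ((2 - (d:ℝ)) / 2) * lap (fun z => g z) y =
    ∫ y, ((2 - d) * d * c ^ 2 * (1 + c ^ 2 * ‖y - x‖ ^ 2) ^ (-((d : ℝ) + 2) / 2)) * g y := by
  have hd' : (3:ℝ) ≤ d := by exact_mod_cast hd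
  simp_rw [← U_lap _ c x _ rfl]
  set p := (2 - (d:ℝ)) / 2 with hp
  have hv : ∀ j, ‖canE d j‖ = 1 := by intro j; simp [canE]
  have hb := fun j => U_bounds p c (by rw [hp]; linarith) hc x (canE d j) (hv j)
  choose C C' C'' h1 h2 h3 using hb
  have hs := U_contDiff p c x
  simp_rw [lap, Finset.mul_sum, Finset.sum_mul]
  rw [integral_finsetSum, integral_finsetSum]
  · refine Finset.sum_congr rfl fun j _ => ?_
    exact ibp2 (canE d j) hs (C j) (C' j) (C'' j) (h1 j) (h2 j) (h3 j) g
  · intro j _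
    refine int_bdd ?_ (C'' j) (h3 j) g
    have hf' : ContDiff ℝ 1 (fun y => fderiv ℝ (fun y : EE d => (1 + c ^ 2 * ‖y - x‖ ^ 2) ^ p) y
        (canE d j)) :=
      (hs.fderiv_right (m := 1) (by norm_num)).clm_apply contDiff_const
    exact (hf'.continuous_fderiv (by norm_num)).clm_apply continuous_const
  · intro j _
    simpa only [dS_apply] using int_bdd hs.continuous (C j) (h1 j)
      (dS (canE d j) (dS (canE d j) g))
lemma radial_const (d : ℕ) (hd : 3 ≤ d) :
    ∫ z : EE d, (1 + ‖z‖ ^ 2) ^ (-((d : ℝ) + 2) / 2) =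
      (volume : Measure (EE d)).real (Metric.ball 0 1) := by
  have hd0 : (0:ℝ) < d := by exact_mod_cast (by omega : 0 < d)
  have : Nontrivial (EE d) := by
    have : Nonempty (Fin d) := ⟨⟨0, by omega⟩⟩
    infer_instance
  rw [integral_fun_norm_addHaar volume (fun r : ℝ => (1 + r ^ 2) ^ (-((d : ℝ) + 2) / 2))]
  simp only [finrank_euclideanSpace, Fintype.card_fin, smul_eq_mul]
  have h : ∫ r in Set.Ioi (0:ℝ), r ^ (d - 1) * (1 + r ^ 2) ^ (-((d : ℝ) + 2) / 2) = 1 / (d:ℝ) - 0 := by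
    have hz : (fun r : ℝ => r ^ d * (1 + r ^ 2) ^ (-(d : ℝ) / 2) / d) 0 = 0 := by
      simp [show d ≠ 0 by omega]
    conv_rhs => arg 2; rw [← hz]
    apply integral_Ioi_of_hasDerivAt_of_nonneg'
      (g := fun r : ℝ => r ^ d * (1 + r ^ 2) ^ (-(d : ℝ) / 2) / d)
    · intro r hr
      have hU : 0 < 1 + r ^ 2 := by positivity
      have h1 : HasDerivAt (fun r : ℝ => 1 + r ^ 2) (2 * r) r := by
        simpa using (hasDerivAt_pow 2 r).const_add 1
      have h2 := ((hasDerivAt_pow d r).mul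
        (h1.rpow_const (p := -(d : ℝ) / 2) (Or.inl hU.ne'))).div_const (d : ℝ)
      refine h2.congr_deriv ?_
      have e1 : -((d : ℝ) + 2) / 2 = -(d:ℝ) / 2 - 1 := by ring
      have e2 : (1 + r ^ 2) ^ (-(d:ℝ) / 2) = (1 + r ^ 2) ^ (-(d:ℝ) / 2 - 1) * (1 + r ^ 2) := by
        rw [← Real.rpow_add_one hU.ne']; ring_nf
      have e3 : r ^ d = r ^ (d - 1) * r := by rw [← pow_succ]; congr 1; omega
      rw [e1, e2, e3]
      field_simp
      ring
    · intro r hr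
      have : (0:ℝ) < r := hr
      positivity
    · have h1 : Tendsto (fun r : ℝ => ((1:ℝ) - (1 + r ^ 2)⁻¹) ^ ((d:ℝ) / 2) / (d:ℝ)) atTop
          (𝓝 (((1:ℝ) - 0) ^ ((d:ℝ) / 2) / (d:ℝ))) := by
        refine Tendsto.div_const (Tendsto.rpow_const (Tendsto.const_sub _ ?_) (by norm_num)) _
        apply Tendsto.inv_tendsto_atTop
        exact tendsto_atTop_add_const_left _ _ (tendsto_pow_atTop (by norm_num))
      rw [sub_zero, Real.one_rpow] at h1
      refine h1.congr' ?_
      filter_upwards [eventually_gt_atTop 0] with r hr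
      have hU : 0 < 1 + r ^ 2 := by positivity
      have : 1 - (1 + r ^ 2)⁻¹ = r ^ 2 / (1 + r ^ 2) := by field_simp; ring
      rw [this, Real.div_rpow (by positivity) hU.le, neg_div, Real.rpow_neg hU.le,
        ← Real.rpow_natCast r 2, ← Real.rpow_mul hr.le, ← Real.rpow_natCast r d]
      rw [show ((2:ℕ):ℝ) * ((d:ℝ) / 2) = d by push_cast; ring]
      rfl
  rw [h, nsmul_eq_mul]
  field_simp
  ring

lemma const_one (d : ℕ) (hd : 3 ≤ d) :
    (d : ℝ) * (d - 2) * (Real.Gamma ((d : ℝ) / 2 - 1) / (4 * Real.pi ^ ((d : ℝ) / 2))) *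
      (volume : Measure (EE d)).real (Metric.ball 0 1) = 1 := by
  have hd' : (3:ℝ) ≤ d := by exact_mod_cast hd
  have : Nonempty (Fin d) := ⟨⟨0, by omega⟩⟩
  have hG : Real.Gamma ((d:ℝ) / 2 + 1) = (d:ℝ) / 2 * ((d:ℝ) / 2 - 1) * Real.Gamma ((d:ℝ)/2 - 1) := by
    rw [Real.Gamma_add_one (by linarith)]
    have := Real.Gamma_add_one (s := (d:ℝ) / 2 - 1) (by linarith)
    rw [sub_add_cancel] at this
    rw [this]; ring
  have hGp : 0 < Real.Gamma ((d:ℝ)/2 - 1) := Real.Gamma_pos_of_pos (by linarith)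
  have hGp2 : 0 < Real.Gamma ((d:ℝ)/2 + 1) := Real.Gamma_pos_of_pos (by linarith)
  rw [Measure.real, EuclideanSpace.volume_ball]
  have hs : √π ^ d = π ^ ((d:ℝ) / 2) := by
    rw [Real.sqrt_eq_rpow, ← Real.rpow_natCast, ← Real.rpow_mul Real.pi_pos.le]; ring_nf
  simp only [Fintype.card_fin, ENNReal.ofReal_one, one_pow, one_mul]
  rw [ENNReal.toReal_ofReal (by positivity), hs, hG]
  have hpp : 0 < π ^ ((d:ℝ) / 2) := Real.rpow_pos_of_pos Real.pi_pos _
  have h2 : (d:ℝ) - 2 ≠ 0 := by linarith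
  have h4 : (d:ℝ) / 2 - 1 = ((d:ℝ) - 2) / 2 := by ring
  have hd0 : (d:ℝ) ≠ 0 := by linarith
  generalize Real.Gamma ((d:ℝ) / 2 - 1) = t at hGp
  rw [h4]
  have := hGp.ne'
  field_simp
  ring

lemma approx_id {d : ℕ} (hd : 3 ≤ d) (x : EE d) (g : SchwartzMap (EE d) ℝ) :
    Tendsto (fun c : ℝ => ∫ y, (c ^ d * ((d : ℝ) * (d - 2) *
      (Real.Gamma ((d : ℝ) / 2 - 1) / (4 * Real.pi ^ ((d : ℝ) / 2))) *
      (1 + ‖c • (x - y)‖ ^ 2) ^ (-((d : ℝ) + 2) / 2))) * g y) atTop (𝓝 (g x)) := by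
  have hd' : (3:ℝ) ≤ d := by exact_mod_cast hd
  set A := (d : ℝ) * (d - 2) *
      (Real.Gamma ((d : ℝ) / 2 - 1) / (4 * Real.pi ^ ((d : ℝ) / 2))) with hA
  have hA0 : 0 ≤ A := by
    have hGp : 0 < Real.Gamma ((d:ℝ)/2 - 1) := Real.Gamma_pos_of_pos (by linarith)
    have : 0 ≤ (d:ℝ) - 2 := by linarith
    positivity
  have := tendsto_integral_comp_smul_smul_of_integrable' (μ := (volume : Measure (EE d)))
    (φ := fun z : EE d => A * (1 + ‖z‖ ^ 2) ^ (-((d : ℝ) + 2) / 2))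
    (fun z => by positivity) ?_ ?_ (g := g) (x₀ := x) g.integrable g.continuous.continuousAt
  · simpa only [finrank_euclideanSpace, Fintype.card_fin, smul_eq_mul] using this
  · rw [integral_const_mul, radial_const d hd, hA, const_one d hd]
  · simp only [finrank_euclideanSpace, Fintype.card_fin]
    have hl : Tendsto (fun z : EE d => A * (1 + ‖z‖ ^ 2)⁻¹) (Bornology.cobounded (EE d)) (𝓝 (A * 0)) := by
      refine Tendsto.const_mul _ (Tendsto.inv_tendsto_atTop ?_)
      exact tendsto_atTop_add_const_left _ _
        ((tendsto_pow_atTop (by norm_num)).comp tendsto_norm_cobounded_atTop)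
    rw [mul_zero] at hl
    refine squeeze_zero (fun z => by positivity) (fun z => ?_) hl
    have hU : 0 < 1 + ‖z‖ ^ 2 := by positivity
    have e1 : -((d : ℝ) + 2) / 2 = -((d:ℝ) / 2) + (-1) := by ring
    rw [e1, Real.rpow_add hU, Real.rpow_neg_one, Real.rpow_neg hU.le]
    have e2 : ‖z‖ ^ d ≤ (1 + ‖z‖ ^ 2) ^ ((d:ℝ) / 2) := by
      calc ‖z‖ ^ d = (‖z‖ ^ 2) ^ ((d:ℝ) / 2) := by
            rw [← Real.rpow_natCast ‖z‖ 2, ← Real.rpow_mul (norm_nonneg _), ← Real.rpow_natCast ‖z‖ d]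
            congr 1; push_cast; ring
        _ ≤ _ := by gcongr; linarith
    have hV : 0 < (1 + ‖z‖ ^ 2) ^ ((d:ℝ) / 2) := Real.rpow_pos_of_pos hU _
    calc _ = (A * (1 + ‖z‖ ^ 2)⁻¹) * (‖z‖ ^ d / (1 + ‖z‖ ^ 2) ^ ((d:ℝ) / 2)) := by ring
      _ ≤ _ := mul_le_of_le_one_right (by positivity) ((div_le_one hV).2 e2)

lemma newton_int {d : ℕ} (hd : 3 ≤ d) (x : EE d) (h : SchwartzMap (EE d) ℝ) :
    Integrable (fun y => ‖y - x‖ ^ ((2:ℝ) - d) * |h y|) := by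
  have hd' : (3:ℝ) ≤ d := by exact_mod_cast hd
  have : Nontrivial (EE d) := by
    have : Nonempty (Fin d) := ⟨⟨0, by omega⟩⟩
    infer_instance
  have h1 : IntegrableOn (fun z : EE d => ‖z‖ ^ ((2:ℝ) - d)) (Metric.ball 0 1) := by
    rw [integrableOn_fun_norm_addHaar volume (f := fun r : ℝ => r ^ ((2:ℝ) - d))]
    simp only [finrank_euclideanSpace, Fintype.card_fin, smul_eq_mul]
    have h0 : IntegrableOn (fun r : ℝ => r ^ (1:ℝ)) (Set.Ioo 0 1) :=
      (intervalIntegral.integrableOn_Ioo_rpow_iff one_pos).2 (by norm_num)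
    refine h0.congr_fun (fun r hr => ?_) measurableSet_Ioo
    have hr0 : 0 < r := hr.1
    simp only
    rw [← Real.rpow_natCast, ← Real.rpow_add hr0, Nat.cast_sub (by omega)]
    congr 1; push_cast; ring
  rw [← integrable_indicator_iff measurableSet_ball] at h1
  have h2 := h1.comp_sub_right x
  obtain ⟨M, hM⟩ : ∃ M : ℝ, ∀ y, |h y| ≤ M :=
    ⟨_, fun y => SchwartzMap.norm_le_seminorm ℝ h y⟩
  have h3 := (h2.const_mul M).add h.integrable.abs
  refine h3.mono' ?_ (ae_of_all _ fun y => ?_)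
  · apply AEStronglyMeasurable.mul
    · apply Measurable.aestronglyMeasurable
      fun_prop
    · exact h.continuous.abs.aestronglyMeasurable
  · have hn : 0 ≤ ‖y - x‖ ^ ((2:ℝ) - d) := by positivity
    rw [Real.norm_eq_abs, abs_of_nonneg (by positivity)]
    simp only [Pi.add_apply]
    by_cases hy : y - x ∈ Metric.ball (0 : EE d) 1
    · rw [Set.indicator_of_mem hy]
      have := mul_le_mul_of_nonneg_left (hM y) hn
      have := abs_nonneg (h y)
      linarith
    · rw [Set.indicator_of_notMem hy]
      have hy' : 1 ≤ ‖y - x‖ := by simpa using hy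
      have : ‖y - x‖ ^ ((2:ℝ) - d) ≤ 1 :=
        Real.rpow_le_one_of_one_le_of_nonpos hy' (by linarith)
      have := mul_le_of_le_one_left (abs_nonneg (h y)) this
      linarith

lemma newton_lim {d : ℕ} (hd : 3 ≤ d) (x : EE d) (h : SchwartzMap (EE d) ℝ) :
    Tendsto (fun c : ℝ => ∫ y, c ^ (d - 2) * (1 + c ^ 2 * ‖y - x‖ ^ 2) ^ ((2 - (d:ℝ)) / 2) * h y)
      atTop (𝓝 (∫ y, ‖y - x‖ ^ ((2:ℝ) - d) * h y)) := by
  have hd' : (3:ℝ) ≤ d := by exact_mod_cast hd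
  have : Nontrivial (EE d) := by
    have : Nonempty (Fin d) := ⟨⟨0, by omega⟩⟩
    infer_instance
  have hre : ∀ c : ℝ, 0 < c → ∀ y : EE d,
      c ^ (d - 2) * (1 + c ^ 2 * ‖y - x‖ ^ 2) ^ ((2 - (d:ℝ)) / 2) =
      ((c ^ 2)⁻¹ + ‖y - x‖ ^ 2) ^ ((2 - (d:ℝ)) / 2) := by
    intro c hc y
    have e1 : 1 + c ^ 2 * ‖y - x‖ ^ 2 = c ^ 2 * ((c ^ 2)⁻¹ + ‖y - x‖ ^ 2) := by field_simp
    rw [e1, Real.mul_rpow (by positivity) (by positivity), ← mul_assoc]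
    have : c ^ (d - 2) * (c ^ 2) ^ ((2 - (d:ℝ)) / 2) = 1 := by
      rw [← Real.rpow_natCast c 2, ← Real.rpow_mul hc.le, ← Real.rpow_natCast c (d - 2),
        ← Real.rpow_add hc, Nat.cast_sub (by omega)]
      convert Real.rpow_zero c using 2
      push_cast; ring
    rw [this, one_mul]
  have hsq : ∀ y : EE d, ‖y - x‖ ^ ((2:ℝ) - d) = (‖y - x‖ ^ 2) ^ ((2 - (d:ℝ)) / 2) := by
    intro y
    rw [← Real.rpow_natCast _ 2, ← Real.rpow_mul (norm_nonneg _)]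
    congr 1; push_cast; ring
  have hne : ∀ᵐ y : EE d, y ≠ x := by simp [ae_iff]
  refine tendsto_integral_filter_of_dominated_convergence _ ?_ ?_ (newton_int hd x h) ?_
  · refine Eventually.of_forall fun c => ?_
    apply AEStronglyMeasurable.mul
    · apply Measurable.aestronglyMeasurable
      fun_prop
    · exact h.continuous.aestronglyMeasurable
  · filter_upwards [eventually_gt_atTop 0] with c hc
    filter_upwards [hne] with y hy
    have hp : 0 < ‖y - x‖ := norm_pos_iff.2 (sub_ne_zero.2 hy)
    rw [hre c hc, hsq, norm_mul, Real.norm_eq_abs, Real.norm_eq_abs, abs_of_nonneg (by positivity)]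
    gcongr ?_ * _
    apply Real.rpow_le_rpow_of_nonpos (by positivity) _ (by linarith)
    have : 0 < (c ^ 2)⁻¹ := by positivity
    linarith
  · filter_upwards [hne] with y hy
    have hp : 0 < ‖y - x‖ := norm_pos_iff.2 (sub_ne_zero.2 hy)
    have ht : Tendsto (fun c : ℝ => ((c ^ 2)⁻¹ + ‖y - x‖ ^ 2) ^ ((2 - (d:ℝ)) / 2) * h y) atTop
        (𝓝 ((0 + ‖y - x‖ ^ 2) ^ ((2 - (d:ℝ)) / 2) * h y)) := by
      refine Tendsto.mul_const _ (Tendsto.rpow_const (Tendsto.add_const _ ?_) (Or.inl (by positivity)))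
      exact Tendsto.inv_tendsto_atTop (tendsto_pow_atTop (by norm_num))
    rw [zero_add, ← hsq] at ht
    refine ht.congr' ?_
    filter_upwards [eventually_gt_atTop 0] with c hc
    rw [hre c hc]

/-- the Newtonian potential of the Laplacian of a Schwartz function
reproduces the function: `∫ G(x−y) Δg(y) dy = g(x)` for `d ≥ 3`. -/
theorem stmt16 (d : ℕ) (hd : 3 ≤ d)
    (g : SchwartzMap (EuclideanSpace ℝ (Fin d)) ℝ) :
    ∀ x : EuclideanSpace ℝ (Fin d),
      ∫ y, fundSol d (x - y) * lap (fun z => g z) y = g x := by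
  intro x
  set k := Real.Gamma ((d : ℝ) / 2 - 1) / (4 * Real.pi ^ ((d : ℝ) / 2)) with hk
  have h1 := (newton_lim hd x (∑ j, dS (canE d j) (dS (canE d j) g))).const_mul (-k)
  simp_rw [← lap_schwartz] at h1
  have h2 := approx_id hd x g
  have h3 : ∫ y, fundSol d (x - y) * lap (fun z => g z) y =
      -k * ∫ y, ‖y - x‖ ^ ((2:ℝ) - d) * lap (fun z => g z) y := by
    rw [← integral_const_mul]
    congr 1; ext y
    rw [fundSol, norm_sub_rev x y, hk]; ring
  rw [h3]
  refine tendsto_nhds_unique (h1.congr' ?_) h2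
  filter_upwards [eventually_gt_atTop 0] with c hc
  simp_rw [mul_assoc (c ^ (d - 2))]
  rw [integral_const_mul, green c hd hc x g, ← integral_const_mul, ← integral_const_mul]
  congr 1; ext y
  have e : c ^ d = c ^ (d - 2) * c ^ 2 := by rw [← pow_add]; congr 1; omega
  rw [norm_smul, mul_pow, Real.norm_eq_abs, sq_abs, norm_sub_rev x y, e, ← hk]
  ring
end
end

section
/- Let d ≥ 3 and let F : EuclideanSpace ℝ (Fin d) → EuclideanSpace ℝ (Fin d) be a vector field each of whose components is a Schwartz function. Let Φ = div F, φ(x) = ∫_{ℝ^d} Φ(y)·G(x−y) dy with G(x) = −(Γ(d/2−1)/(4π^{d/2}))·‖x‖^{2−d}, and let F^p = ∇φ be the potential part of F. Then the transversal Radon transform of F equals that of its potential part: for every unit vector ω and every p ∈ ℝ, ∫_{y ∈ (ℝ∙ω)ᗮ} ⟪ω, F(p•ω+y)⟫ dy = ∫_{y ∈ (ℝ∙ω)ᗮ} ⟪ω, F^p(p•ω+y)⟫ dy, both integrals being well defined. -/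
open MeasureTheory Real
open scoped RealInnerProductSpace

noncomputable section

set_option linter.unusedSectionVars false
section R17
variable {E : Type*} [NormedAddCommGroup E] [InnerProductSpace ℝ E] [FiniteDimensional ℝ E]
  [MeasurableSpace E] [BorelSpace E]

/-- splitting equivalence -/
def spl (ω : E) (hω : ‖ω‖ = 1) : (ℝ × (ℝ ∙ ω)ᗮ) ≃ᵐ E :=
  ((LinearIsometryEquiv.toSpanUnitSingleton (𝕜 := ℝ) ω hω).toHomeomorph.toMeasurableEquiv.prodCongr
    (MeasurableEquiv.refl _)).trans
    ((MeasurableEquiv.toLp 2 ((ℝ ∙ ω) × (ℝ ∙ ω)ᗮ)).trans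
      ((ℝ ∙ ω).orthogonalDecomposition.symm.toHomeomorph.toMeasurableEquiv))

theorem spl_apply (ω : E) (hω : ‖ω‖ = 1) (z : ℝ × (ℝ ∙ ω)ᗮ) :
    spl ω hω z = z.1 • ω + (z.2 : E) := by
  simp [spl]
  rfl

theorem spl_mp (ω : E) (hω : ‖ω‖ = 1) : MeasurePreserving (spl ω hω) volume volume := by
  unfold spl
  refine MeasurePreserving.trans (MeasurePreserving.prod (LinearIsometryEquiv.measurePreserving _) (MeasurePreserving.id _)) ?_
  refine MeasurePreserving.trans (WithLp.volume_preserving_toLp _ _) ?_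
  exact LinearIsometryEquiv.measurePreserving _

theorem norm_split (ω : E) (hω : ‖ω‖ = 1) (s : ℝ) (h : (ℝ ∙ ω)ᗮ) :
    ‖s • ω + (h : E)‖ ^ 2 = s ^ 2 + ‖h‖ ^ 2 := by
  have h0 : ⟪ω, (h : E)⟫ = 0 := Submodule.mem_orthogonal_singleton_iff_inner_right.1 h.2
  rw [norm_add_sq_real, inner_smul_left, h0, norm_smul, hω]
  simp

theorem inner_split (ω : E) (hω : ‖ω‖ = 1) (s : ℝ) (h : (ℝ ∙ ω)ᗮ) :
    ⟪s • ω + (h : E), ω⟫ = s := by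
  have h0 : ⟪(h : E), ω⟫ = 0 := Submodule.mem_orthogonal_singleton_iff_inner_left.1 h.2
  rw [inner_add_left, inner_smul_left, h0, real_inner_self_eq_norm_sq, hω]
  simp

theorem integrable_split (ω : E) (hω : ‖ω‖ = 1) {f : E → ℝ} (hf : Integrable f) :
    Integrable (fun z : ℝ × (ℝ ∙ ω)ᗮ => f (z.1 • ω + (z.2 : E))) (volume.prod volume) := by
  have := (spl_mp ω hω).integrable_comp_of_integrable hf
  simp only [Function.comp_def, spl_apply] at this
  exact this

theorem integral_split (ω : E) (hω : ‖ω‖ = 1) {f : E → ℝ}  :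
    ∫ x, f x = ∫ z : ℝ × (ℝ ∙ ω)ᗮ, f (z.1 • ω + (z.2 : E)) ∂(volume.prod volume) := by
  have := (spl_mp ω hω).integral_comp (spl ω hω).measurableEmbedding f
  simp only [spl_apply] at this
  exact this.symm

theorem finrank_H (ω : E) (hω : ‖ω‖ = 1) : Module.finrank ℝ (ℝ ∙ ω)ᗮ + 1 = Module.finrank ℝ E := by
  have := Submodule.finrank_add_finrank_orthogonal (ℝ ∙ ω)
  rw [finrank_span_singleton (by rintro rfl; simp at hω)] at this
  omega

/-- decay -/
theorem schwartz_decay {V : Type*} [NormedAddCommGroup V] [NormedSpace ℝ V]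
    (f : SchwartzMap E V) (k : ℕ) : ∃ C : ℝ, 0 ≤ C ∧ ∀ x, ‖f x‖ ≤ C * (1 + ‖x‖) ^ (-(k:ℝ)) := by
  refine ⟨2 ^ k * ((Finset.Iic (k, 0)).sup fun m => SchwartzMap.seminorm ℝ m.1 m.2) f, by positivity, fun x => ?_⟩
  have := SchwartzMap.one_add_le_sup_seminorm_apply (𝕜 := ℝ) (m := (k, 0)) le_rfl le_rfl f x
  rw [norm_iteratedFDeriv_zero] at this
  rw [rpow_neg (by positivity), rpow_natCast, ← div_eq_mul_inv, le_div_iff₀ (by positivity)]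
  linarith

/-- restriction of Schwartz functions to hyperplanes is integrable -/
theorem integrable_H (ω : E) (hω : ‖ω‖ = 1) {V : Type*} [NormedAddCommGroup V] [NormedSpace ℝ V]
    (f : SchwartzMap E V) (p : ℝ) :
    Integrable (fun h : (ℝ ∙ ω)ᗮ => f (p • ω + (h : E))) volume := by
  obtain ⟨C, hC, hb⟩ := schwartz_decay f (Module.finrank ℝ (ℝ ∙ ω)ᗮ + 1)
  have hi : Integrable (fun h : (ℝ ∙ ω)ᗮ => (1 + ‖h‖) ^ (-((Module.finrank ℝ (ℝ ∙ ω)ᗮ + 1 : ℕ) : ℝ))) volume :=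
    integrable_one_add_norm (by push_cast; linarith)
  refine (hi.const_mul C).mono' ?_ ?_
  · have : Continuous (fun h : (ℝ ∙ ω)ᗮ => f (p • ω + (h : E))) := by
      have := f.continuous
      fun_prop
    exact this.aestronglyMeasurable
  · refine Filter.Eventually.of_forall fun h => (hb _).trans ?_
    gcongr ?_ * ?_
    refine rpow_le_rpow_of_nonpos (by positivity) ?_ (by rw [neg_nonpos]; positivity)
    have := norm_split ω hω p h
    have : ‖h‖ ≤ ‖p • ω + (h:E)‖ := by
      apply abs_le_of_sq_le_sq' _ (by positivity) |>.2
      nlinarith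
    linarith

theorem tend_line (ω : E) (hω : ‖ω‖ = 1) (f : SchwartzMap E ℝ) (h : E) (l : Filter ℝ) (hl : Filter.Tendsto (fun s : ℝ => |s|) l Filter.atTop) :
    Filter.Tendsto (fun s : ℝ => f (s • ω + h)) l (nhds 0) := by
  have h1 := f.tendsto_cocompact
  refine h1.comp ?_
  refine Filter.Tendsto.comp (g := fun x => x + h) (f := fun s : ℝ => s • ω) (y := Filter.cocompact E) ?_ ?_
  · exact (Homeomorph.addRight h).isClosedEmbedding.tendsto_cocompact
  · rw [← Metric.cobounded_eq_cocompact]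
    apply tendsto_norm_atTop_iff_cobounded.1
    simpa [norm_smul, hω] using hl
end R17

section R17b
variable {H : Type*} [NormedAddCommGroup H] [InnerProductSpace ℝ H] [FiniteDimensional ℝ H]
  [MeasurableSpace H] [BorelSpace H]

theorem gauss_aux (q : ℝ) (hq : q ≠ 0) :
    Integrable (fun h : H => (q ^ 2 + ‖h‖ ^ 2) ^ (-(((Module.finrank ℝ H : ℝ) + 1) / 2))) ∧
    ∫ h : H, (q ^ 2 + ‖h‖ ^ 2) ^ (-(((Module.finrank ℝ H : ℝ) + 1) / 2)) =
      π ^ (((Module.finrank ℝ H : ℝ) + 1) / 2) / Gamma (((Module.finrank ℝ H : ℝ) + 1) / 2) / |q| := by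
  set m : ℝ := (Module.finrank ℝ H : ℝ) with hm
  have hm0 : 0 ≤ m := by positivity
  set a : ℝ := (m + 1) / 2 with ha
  have ha0 : 0 < a := by positivity
  have hq2 : 0 < q ^ 2 := by positivity
  have hG : 0 < Gamma a := Gamma_pos_of_pos ha0
  set g : H × ℝ → ℝ := fun z => z.2 ^ (a - 1) * exp (-((q ^ 2 + ‖z.1‖ ^ 2) * z.2)) with hg
  have hgm : Measurable g := by
    simp only [hg]
    fun_prop
  have hint1 : ∀ h : H, ∫ t in Set.Ioi 0, g (h, t) = Gamma a * (q ^ 2 + ‖h‖ ^ 2) ^ (-a) := by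
    intro h
    simp only [hg]
    rw [integral_rpow_mul_exp_neg_mul_Ioi ha0 (by positivity), one_div, inv_rpow (by positivity),
      rpow_neg (by positivity)]
    ring
  have hint2' : ∀ t ∈ Set.Ioi (0:ℝ), ∀ h, g (h, t) = t ^ (a - 1) * exp (-(q ^ 2 * t)) * exp (- t * ‖h‖ ^ 2) := by
    intro t ht h
    simp only [hg]
    rw [mul_assoc, ← exp_add]
    ring_nf
  have hint2 : ∀ t ∈ Set.Ioi (0:ℝ), ∫ h, g (h, t) = π ^ (m / 2) * (t ^ ((1/2 : ℝ) - 1) * exp (-(q ^ 2 * t))) := by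
    intro t ht
    have ht : 0 < t := ht
    simp_rw [hint2' t ht]
    rw [integral_const_mul, GaussianFourier.integral_rexp_neg_mul_sq_norm ht, ← hm, div_rpow pi_pos.le ht.le]
    have : t ^ (a - 1) = t ^ ((1/2 : ℝ) - 1) * t ^ (m / 2) := by
      rw [← rpow_add ht]; congr 1; rw [ha]; ring
    rw [this]
    have : t ^ (m / 2) ≠ 0 := (rpow_pos_of_pos ht _).ne'
    field_simp
  have hi0 : ∫ t in Set.Ioi (0:ℝ), t ^ ((1/2 : ℝ) - 1) * exp (-(q ^ 2 * t)) = π ^ (1/2 : ℝ) / |q| := by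
    rw [integral_rpow_mul_exp_neg_mul_Ioi (by norm_num) hq2, Gamma_one_half_eq, ← sqrt_eq_rpow, ← sqrt_eq_rpow,
      one_div, sqrt_inv, sqrt_sq_eq_abs]
    ring
  have hii : IntegrableOn (fun t => π ^ (m / 2) * (t ^ ((1/2 : ℝ) - 1) * exp (-(q ^ 2 * t)))) (Set.Ioi 0) := by
    refine Integrable.const_mul ?_ _
    apply Integrable.of_integral_ne_zero
    rw [hi0]; positivity
  have hgi : Integrable g (volume.prod (volume.restrict (Set.Ioi 0))) := by
    rw [integrable_prod_iff' hgm.aestronglyMeasurable]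
    constructor
    · refine (ae_restrict_iff' measurableSet_Ioi).2 (Filter.Eventually.of_forall fun t ht => ?_)
      apply Integrable.of_integral_ne_zero
      rw [hint2 t ht]
      have ht : 0 < t := ht
      positivity
    · refine hii.congr_fun ?_ measurableSet_Ioi
      intro t ht
      simp only
      rw [← hint2 t ht]
      congr 1; ext h
      have ht : 0 < t := ht
      rw [norm_of_nonneg]
      simp only [hg]
      positivity
  have hL := hgi.integral_prod_left
  simp only [hint1] at hL
  have hS := integral_integral_swap (f := fun h t => g (h, t)) (by simpa [Function.uncurry_def] using hgi)
  simp only [hint1] at hS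
  rw [setIntegral_congr_fun measurableSet_Ioi hint2, integral_const_mul, integral_const_mul, hi0] at hS
  constructor
  · have := hL.const_mul (Gamma a)⁻¹
    refine this.congr (Filter.Eventually.of_forall fun h => ?_)
    simp only
    field_simp
  · have h3 : π ^ a = π ^ (m/2) * π ^ (1/2 : ℝ) := by
      rw [← rpow_add pi_pos]; congr 1; rw [ha]; ring
    rw [h3]
    field_simp
    field_simp at hS
    linarith
end R17b

section R17c
variable {E : Type*} [NormedAddCommGroup E] [InnerProductSpace ℝ E] [FiniteDimensional ℝ E]
  [MeasurableSpace E] [BorelSpace E]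

/-- the directional derivative of the fundamental solution -/
def KK (ω y : E) : ℝ := Gamma ((Module.finrank ℝ E : ℝ) / 2) / (2 * π ^ ((Module.finrank ℝ E : ℝ) / 2)) *
  (⟪y, ω⟫ * ‖y‖ ^ (-(Module.finrank ℝ E : ℝ)))

theorem KK_abs (ω : E) (hω : ‖ω‖ = 1) : ∃ C, 0 ≤ C ∧ ∀ y : E, |KK ω y| ≤ C * ‖y‖ ^ (1 - (Module.finrank ℝ E : ℝ)) := by
  refine ⟨|Gamma ((Module.finrank ℝ E : ℝ) / 2) / (2 * π ^ ((Module.finrank ℝ E : ℝ) / 2))|, abs_nonneg _, fun y => ?_⟩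
  unfold KK
  rw [abs_mul]
  gcongr
  rcases eq_or_ne y 0 with rfl | hy
  · simp; positivity
  rw [abs_mul, sub_eq_add_neg, rpow_add (norm_pos_iff.2 hy), rpow_one, abs_of_nonneg (a := ‖y‖ ^ _) (by positivity)]
  gcongr
  have := abs_real_inner_le_norm y ω
  rwa [hω, mul_one] at this

theorem KK_meas (ω : E) : Measurable (KK ω) := by
  unfold KK
  fun_prop

theorem KK_int (ω : E) (hω : ‖ω‖ = 1) (q : ℝ) :
    Integrable (fun h : (ℝ ∙ ω)ᗮ => KK ω (q • ω + (h : E))) ∧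
    ∫ h : (ℝ ∙ ω)ᗮ, KK ω (q • ω + (h : E)) = SignType.sign q / 2 ∧
    ∫ h : (ℝ ∙ ω)ᗮ, ‖KK ω (q • ω + (h : E))‖ ≤ 1 / 2 := by
  unfold KK
  rcases eq_or_ne q 0 with rfl | hq
  · simp only [inner_split ω hω]
    simp
  have hr : (Module.finrank ℝ E : ℝ) = Module.finrank ℝ (ℝ ∙ ω)ᗮ + 1 := by
    rw [← finrank_H ω hω]; push_cast; ring
  have hpow : ∀ h : (ℝ ∙ ω)ᗮ, ‖q • ω + (h : E)‖ ^ (-(Module.finrank ℝ E : ℝ)) =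
      (q ^ 2 + ‖h‖ ^ 2) ^ (-(((Module.finrank ℝ (ℝ ∙ ω)ᗮ : ℝ) + 1) / 2)) := by
    intro h
    rw [← norm_split ω hω, ← rpow_natCast, ← rpow_mul (norm_nonneg _), hr]
    congr 1; push_cast; ring
  obtain ⟨h1, h2⟩ := gauss_aux (H := (ℝ ∙ ω)ᗮ) q hq
  simp only [inner_split ω hω, hpow]
  simp only [hr]
  set m : ℝ := (Module.finrank ℝ (ℝ ∙ ω)ᗮ : ℝ)
  have hG : 0 < Gamma ((m + 1) / 2) := Gamma_pos_of_pos (by positivity)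
  have hP : 0 < π ^ ((m + 1) / 2) := by positivity
  refine ⟨(h1.const_mul _).const_mul _, ?_, ?_⟩
  · rw [integral_const_mul, integral_const_mul, h2]
    rcases lt_or_gt_of_ne hq with h | h
    · simp only [sign_neg h, abs_of_neg h]
      field_simp; simp
    · simp only [sign_pos h, abs_of_pos h]
      field_simp; simp
  · simp only [norm_mul]
    rw [integral_const_mul, integral_const_mul]
    have : ∀ h : (ℝ ∙ ω)ᗮ, ‖(q ^ 2 + ‖h‖ ^ 2) ^ (-((m + 1) / 2))‖ = (q ^ 2 + ‖h‖ ^ 2) ^ (-((m + 1) / 2)) :=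
      fun h => norm_of_nonneg (by positivity)
    simp only [this]
    rw [h2, norm_of_nonneg (by positivity), norm_eq_abs]
    have : 0 < |q| := abs_pos.2 hq
    apply le_of_eq
    field_simp

theorem weight_int (hd : 3 ≤ Module.finrank ℝ E) (β : ℝ) (h1 : 1 - (Module.finrank ℝ E : ℝ) ≤ β)
    (h2 : β ≤ 2 - (Module.finrank ℝ E : ℝ)) :
    Integrable (fun y : E => (1 + ‖y‖) ^ (-((3 : ℕ):ℝ)) * ‖y‖ ^ β) := by
  have : Nontrivial E := Module.nontrivial_of_finrank_pos (R := ℝ) (by omega)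
  rw [integrable_fun_norm_addHaar (volume : Measure E) (f := fun r => (1 + r) ^ (-((3 : ℕ):ℝ)) * r ^ β)]
  have hb : IntegrableOn (fun y : ℝ => (1 + ‖y‖) ^ (-(2:ℝ))) (Set.Ioi 0) :=
    (integrable_one_add_norm (by simp)).integrableOn
  refine Integrable.mono' hb (by fun_prop) ?_
  refine (ae_restrict_iff' measurableSet_Ioi).2 (Filter.Eventually.of_forall fun t ht => ?_)
  have ht : 0 < t := ht
  simp only [smul_eq_mul]
  rw [norm_of_nonneg (by positivity), norm_of_nonneg ht.le]
  have e1 : t ^ (Module.finrank ℝ E - 1) = t ^ ((Module.finrank ℝ E : ℝ) - 1) := by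
    rw [← rpow_natCast, Nat.cast_sub (by omega)]; simp
  have e2 : t ^ ((Module.finrank ℝ E : ℝ) - 1) * t ^ β ≤ 1 + t := by
    rw [← rpow_add ht]
    calc t ^ ((Module.finrank ℝ E : ℝ) - 1 + β) ≤ (1 + t) ^ ((Module.finrank ℝ E : ℝ) - 1 + β) :=
          rpow_le_rpow ht.le (by linarith) (by linarith)
      _ ≤ (1 + t) ^ (1:ℝ) := rpow_le_rpow_of_exponent_le (by linarith) (by linarith)
      _ = 1 + t := rpow_one _
  calc _ = (1 + t) ^ (-((3 : ℕ):ℝ)) * (t ^ ((Module.finrank ℝ E : ℝ) - 1) * t ^ β) := by rw [e1]; ring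
    _ ≤ (1 + t) ^ (-((3 : ℕ):ℝ)) * (1 + t) ^ (1:ℝ) := by rw [rpow_one]; gcongr
    _ = _ := by rw [← rpow_add (by positivity)]; norm_num

theorem weight_bound (hd : 3 ≤ Module.finrank ℝ E) (β : ℝ) (h1 : 1 - (Module.finrank ℝ E : ℝ) ≤ β)
    (h2 : β ≤ 2 - (Module.finrank ℝ E : ℝ)) {V : Type*} [NormedAddCommGroup V] [NormedSpace ℝ V]
    (f : SchwartzMap E V) (x₀ : E) : ∃ b : E → ℝ, Integrable b ∧ 
      ∀ x ∈ Metric.ball x₀ 1, ∀ y, ‖f (x - y)‖ * ‖y‖ ^ β ≤ b y := by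
  obtain ⟨C, hC, hb⟩ := schwartz_decay f 3
  refine ⟨_, (weight_int hd β h1 h2).const_mul (C * (2 + ‖x₀‖) ^ ((3 : ℕ):ℝ)), fun x hx y => ?_⟩
  have hx' : ‖x‖ ≤ ‖x₀‖ + 1 := by
    have := norm_sub_norm_le x x₀
    rw [Metric.mem_ball, dist_eq_norm] at hx
    linarith
  have h3 : 1 + ‖y‖ ≤ (1 + ‖x - y‖) * (2 + ‖x₀‖) := by
    have : ‖y‖ ≤ ‖x - y‖ + ‖x‖ := by
      have := norm_sub_norm_le y x
      rw [norm_sub_rev] at this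
      linarith
    nlinarith [norm_nonneg (x - y), norm_nonneg x₀]
  have h4 : (1 + ‖x - y‖) ^ (-((3 : ℕ):ℝ)) ≤ (2 + ‖x₀‖) ^ ((3 : ℕ):ℝ) * (1 + ‖y‖) ^ (-((3 : ℕ):ℝ)) := by
    rw [rpow_neg (by positivity), rpow_neg (by positivity), ← div_eq_mul_inv, le_div_iff₀ (by positivity),
      inv_mul_le_iff₀ (by positivity), ← mul_rpow (by positivity) (by positivity)]
    exact rpow_le_rpow (by positivity) h3 (by positivity)
  calc _ ≤ (C * (1 + ‖x - y‖) ^ (-((3 : ℕ):ℝ))) * ‖y‖ ^ β := by gcongr; exact hb _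
    _ ≤ (C * ((2 + ‖x₀‖) ^ ((3 : ℕ):ℝ) * (1 + ‖y‖) ^ (-((3 : ℕ):ℝ)))) * ‖y‖ ^ β := by gcongr
    _ = _ := by ring

theorem weight_prod (hd : 3 ≤ Module.finrank ℝ E) (β : ℝ) (h1 : 1 - (Module.finrank ℝ E : ℝ) ≤ β)
    (h2 : β ≤ 2 - (Module.finrank ℝ E : ℝ)) 
    (f : SchwartzMap E ℝ) (x : E) (w : E → ℝ) (hw : Measurable w) (C : ℝ) (hC : 0 ≤ C)
    (hb : ∀ y, |w y| ≤ C * ‖y‖ ^ β) : Integrable (fun y => f (x - y) * w y) := by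
  obtain ⟨b, hbi, hbb⟩ := weight_bound hd β h1 h2 f x
  refine (hbi.const_mul C).mono' ?_ (Filter.Eventually.of_forall fun y => ?_)
  · have := f.continuous
    exact (by fun_prop : Measurable (fun y => f (x - y) * w y)).aestronglyMeasurable
  · rw [norm_mul, norm_eq_abs (w y)]
    calc _ ≤ ‖f (x - y)‖ * (C * ‖y‖ ^ β) := by gcongr; exact hb y
      _ = C * (‖f (x - y)‖ * ‖y‖ ^ β) := by ring
      _ ≤ _ := by gcongr; exact hbb x (by simp) y

theorem phi_deriv (hd : 3 ≤ Module.finrank ℝ E) (f : SchwartzMap E ℝ) (c : ℝ) (x : E) :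
    HasFDerivAt (fun x => ∫ y, f (x - y) * (c * ‖y‖ ^ (2 - (Module.finrank ℝ E : ℝ))))
      (∫ y, (c * ‖y‖ ^ (2 - (Module.finrank ℝ E : ℝ))) • fderiv ℝ f (x - y)) x := by
  obtain ⟨b, hbi, hbb⟩ := weight_bound hd (2 - (Module.finrank ℝ E : ℝ)) (by linarith) le_rfl (SchwartzMap.fderivCLM ℝ E ℝ f) x
  have hfc := f.continuous
  have hwc : ∀ y : E, |c * ‖y‖ ^ (2 - (Module.finrank ℝ E : ℝ))| = |c| * ‖y‖ ^ (2 - (Module.finrank ℝ E : ℝ)) := by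
    intro y
    rw [abs_mul, abs_of_nonneg (a := ‖y‖ ^ _) (by positivity)]
  refine hasFDerivAt_integral_of_dominated_of_fderiv_le (s := Metric.ball x 1) (bound := fun y => |c| * b y)
    (F' := fun x y => (c * ‖y‖ ^ (2 - (Module.finrank ℝ E : ℝ))) • fderiv ℝ f (x - y))
    (Metric.ball_mem_nhds _ one_pos) ?_ ?_ ?_ ?_ (hbi.const_mul _) ?_
  · refine Filter.Eventually.of_forall fun x => Measurable.aestronglyMeasurable (by fun_prop)
  · exact weight_prod hd _ (by linarith) le_rfl f x _ (by fun_prop) |c| (abs_nonneg _) (fun y => (hwc y).le)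
  · have : Continuous (fun y => fderiv ℝ f (x - y)) := by
      have := (SchwartzMap.fderivCLM ℝ E ℝ f).continuous
      exact this.comp (by fun_prop : Continuous fun y => x - y)
    have hm : AEStronglyMeasurable (fun y : E => c * ‖y‖ ^ (2 - (Module.finrank ℝ E : ℝ))) volume :=
      Measurable.aestronglyMeasurable (by fun_prop)
    exact hm.smul this.aestronglyMeasurable
  · refine Filter.Eventually.of_forall fun y x hx => ?_
    rw [norm_smul, norm_eq_abs, hwc, mul_assoc, mul_comm (‖y‖ ^ _)]
    gcongr
    exact hbb x hx y
  · refine Filter.Eventually.of_forall fun y x hx => ?_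
    have h := (f.differentiableAt (x := x - y)).hasFDerivAt.comp x ((hasFDerivAt_id x).sub_const y)
    have h2 := h.mul_const (c * ‖y‖ ^ (2 - (Module.finrank ℝ E : ℝ)))
    simpa [Function.comp_def] using h2

end R17c

section R17d
variable {E : Type*} [NormedAddCommGroup E] [InnerProductSpace ℝ E] [FiniteDimensional ℝ E]
  [MeasurableSpace E] [BorelSpace E]

theorem line_deriv (hd : 3 ≤ Module.finrank ℝ E) (ω : E) (hω : ‖ω‖ = 1) (h : (ℝ ∙ ω)ᗮ) (hh : h ≠ 0) (s : ℝ) :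
    HasDerivAt (fun s : ℝ => -(Gamma ((Module.finrank ℝ E : ℝ) / 2 - 1) / (4 * π ^ ((Module.finrank ℝ E : ℝ) / 2))) *
      ‖s • ω + (h : E)‖ ^ (2 - (Module.finrank ℝ E : ℝ))) (KK ω (s • ω + (h : E))) s := by
  have hpow : ∀ (s : ℝ) (β : ℝ), ‖s • ω + (h : E)‖ ^ β = (s ^ 2 + ‖h‖ ^ 2) ^ (β / 2) := by
    intro s β
    rw [← norm_split ω hω, ← rpow_natCast, ← rpow_mul (norm_nonneg _)]
    congr 1; push_cast; ring
  unfold KK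
  simp only [hpow, inner_split ω hω]
  have hh' : 0 < ‖h‖ := norm_pos_iff.2 hh
  have hd' : (3:ℝ) ≤ (Module.finrank ℝ E : ℝ) := by exact_mod_cast hd
  set D : ℝ := (Module.finrank ℝ E : ℝ)
  have h1 : HasDerivAt (fun s : ℝ => s ^ 2 + ‖h‖ ^ 2) (2 * s) s := by
    simpa using (hasDerivAt_pow 2 s).add_const (‖h‖ ^ 2)
  have h2 := (h1.rpow_const (p := (2 - D) / 2) (Or.inl (by positivity))).const_mul
    (-(Gamma (D / 2 - 1) / (4 * π ^ (D / 2))))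
  refine h2.congr_deriv (Eq.symm ?_)
  have hG : Gamma (D / 2) = (D / 2 - 1) * Gamma (D / 2 - 1) := by
    have := Gamma_add_one (s := D / 2 - 1) (by linarith)
    rwa [sub_add_cancel] at this
  have e : (2 - D) / 2 - 1 = -D / 2 := by ring
  rw [hG, e]
  field_simp
  ring

theorem ibp (hd : 3 ≤ Module.finrank ℝ E) (ω : E) (hω : ‖ω‖ = 1) (f : SchwartzMap E ℝ) (x : E) :
    ∫ y, (-(Gamma ((Module.finrank ℝ E : ℝ) / 2 - 1) / (4 * π ^ ((Module.finrank ℝ E : ℝ) / 2))) *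
      ‖y‖ ^ (2 - (Module.finrank ℝ E : ℝ))) * fderiv ℝ f (x - y) ω = ∫ y, f (x - y) * KK ω y := by
  set c : ℝ := -(Gamma ((Module.finrank ℝ E : ℝ) / 2 - 1) / (4 * π ^ ((Module.finrank ℝ E : ℝ) / 2))) with hc
  set D : ℝ := (Module.finrank ℝ E : ℝ) with hD
  have hwc : ∀ y : E, |c * ‖y‖ ^ (2 - D)| ≤ |c| * ‖y‖ ^ (2 - D) := by
    intro y
    rw [abs_mul, abs_of_nonneg (a := ‖y‖ ^ _) (by positivity)]
  obtain ⟨C, hC, hK⟩ := KK_abs ω hω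
  have i1 := weight_prod hd (2 - D) (by linarith) le_rfl f x _ (by fun_prop) |c| (abs_nonneg _) hwc
  have i2 := weight_prod hd (2 - D) (by linarith) le_rfl (SchwartzMap.evalCLM ℝ E ℝ ω (SchwartzMap.fderivCLM ℝ E ℝ f)) x _ (by fun_prop) |c| (abs_nonneg _) hwc
  have i3 := weight_prod hd (1 - D) le_rfl (by linarith) f x _ (KK_meas ω) C hC hK
  have i2' : Integrable (fun y => (c * ‖y‖ ^ (2 - D)) * fderiv ℝ f (x - y) ω) := by
    refine i2.congr (Filter.Eventually.of_forall fun y => ?_)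
    simp [SchwartzMap.fderivCLM_apply]
    ring
  have j1 := integrable_split ω hω i1
  have j2 := integrable_split ω hω i2'
  have j3 := integrable_split ω hω i3
  rw [integral_split ω hω, integral_split ω hω, integral_prod_symm _ j2, integral_prod_symm _ j3]
  have hnt : Nontrivial (ℝ ∙ ω)ᗮ := Module.nontrivial_of_finrank_pos (R := ℝ) (by have := finrank_H ω hω; omega)
  refine integral_congr_ae ?_
  have hne : ∀ᵐ h : (ℝ ∙ ω)ᗮ, h ≠ 0 := Measure.ae_ne volume 0
  filter_upwards [hne, j1.prod_left_ae, j2.prod_left_ae, j3.prod_left_ae] with h hh k1 k2 k3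
  have hu : ∀ s : ℝ, HasDerivAt (fun s : ℝ => f (x - (s • ω + (h : E)))) (-(fderiv ℝ f (x - (s • ω + (h : E))) ω)) s := by
    intro s
    have a1 : HasDerivAt (fun s : ℝ => x - (s • ω + (h : E))) (-ω) s := by
      simpa using (((hasDerivAt_id s).smul_const ω).add_const (h : E)).const_sub x
    have := (f.differentiableAt (x := x - (s • ω + (h : E)))).hasFDerivAt.comp_hasDerivAt s a1
    simpa [Function.comp_def] using this
  have := integral_mul_deriv_eq_deriv_mul_of_integrable
    (u := fun s : ℝ => f (x - (s • ω + (h : E)))) (v := fun s : ℝ => c * ‖s • ω + (h : E)‖ ^ (2 - D))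
    (u' := fun s => -(fderiv ℝ f (x - (s • ω + (h : E))) ω)) (v' := fun s => KK ω (s • ω + (h : E)))
    (fun s _ => hu s) (fun s _ => line_deriv hd ω hω h hh s) k3 ?_ k1
  · rw [this, ← integral_neg]
    congr 1; ext s; ring
  · refine k2.neg.congr (Filter.Eventually.of_forall fun s => ?_)
    simp only [Pi.neg_apply, Pi.mul_apply]
    ring

theorem sign_int (ω : E) (hω : ‖ω‖ = 1) (f : SchwartzMap E ℝ) (p : ℝ) :
    Integrable (fun z => f z * ((SignType.sign (p - ⟪z, ω⟫) : ℝ) / 2)) := by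
  refine f.integrable.mul_bdd (c := 1) ?_ (Filter.Eventually.of_forall fun z => ?_)
  · refine Measurable.aestronglyMeasurable ?_
    have h1 : Measurable (fun t : ℝ => (SignType.sign t : ℝ)) := by
      have : (fun t : ℝ => (SignType.sign t : ℝ)) = fun t => if 0 < t then 1 else if t < 0 then -1 else 0 := by
        ext t
        rw [sign_apply]
        split_ifs <;> simp
      rw [this]
      refine Measurable.ite measurableSet_Ioi measurable_const (Measurable.ite measurableSet_Iio measurable_const measurable_const)
    exact (h1.comp (by fun_prop : Measurable fun z : E => p - ⟪z, ω⟫)).div_const _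
  · rcases lt_trichotomy (p - ⟪z, ω⟫) 0 with h | h | h
    · simp [sign_neg h]; norm_num
    · simp [h]
    · simp [sign_pos h]; norm_num

theorem tang_zero (ω : E) (hω : ‖ω‖ = 1) (f : SchwartzMap E ℝ) (e : (ℝ ∙ ω)ᗮ) (s : ℝ) :
    ∫ h : (ℝ ∙ ω)ᗮ, fderiv ℝ f (s • ω + (h : E)) e = 0 := by
  have hdv : ∀ h : (ℝ ∙ ω)ᗮ, HasFDerivAt (fun h : (ℝ ∙ ω)ᗮ => f (s • ω + (h : E)))
      ((fderiv ℝ f (s • ω + (h : E))).comp (ℝ ∙ ω)ᗮ.subtypeL) h := by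
    intro h
    have a1 : HasFDerivAt (fun h : (ℝ ∙ ω)ᗮ => s • ω + (h : E)) (ℝ ∙ ω)ᗮ.subtypeL h :=
      ((ℝ ∙ ω)ᗮ.subtypeL.hasFDerivAt).const_add _
    exact (f.differentiableAt (x := s • ω + (h : E))).hasFDerivAt.comp h a1
  have i1 := integrable_H ω hω f s
  have i2 := integrable_H ω hω (SchwartzMap.evalCLM ℝ E ℝ (e : E) (SchwartzMap.fderivCLM ℝ E ℝ f)) s
  have := integral_mul_fderiv_eq_neg_fderiv_mul_of_integrable (μ := (volume : Measure (ℝ ∙ ω)ᗮ))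
    (f := fun _ => (1:ℝ)) (g := fun h : (ℝ ∙ ω)ᗮ => f (s • ω + (h : E))) (v := e) (by simp)
    (by simpa [(hdv _).fderiv] using i2) (by simpa using i1) (by simp) (fun h _ => (hdv h).differentiableAt)
  simpa [(hdv _).fderiv] using this

theorem line_int (ω : E) (hω : ‖ω‖ = 1) (f : SchwartzMap E ℝ) (h : E) (p : ℝ)
    (hi : Integrable fun s : ℝ => fderiv ℝ f (s • ω + h) ω * ((SignType.sign (p - s) : ℝ) / 2)) :
    ∫ s : ℝ, fderiv ℝ f (s • ω + h) ω * ((SignType.sign (p - s) : ℝ) / 2) = f (p • ω + h) := by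
  have hu : ∀ s : ℝ, HasDerivAt (fun s : ℝ => f (s • ω + h)) (fderiv ℝ f (s • ω + h) ω) s := by
    intro s
    have a1 : HasDerivAt (fun s : ℝ => s • ω + h) ω s := by
      simpa using (((hasDerivAt_id s).smul_const ω).add_const h)
    exact (f.differentiableAt (x := s • ω + h)).hasFDerivAt.comp_hasDerivAt s a1
  rw [← integral_add_compl (measurableSet_Iic (a := p)) hi, Set.compl_Iic]
  have c1 : Set.EqOn (fun s : ℝ => fderiv ℝ f (s • ω + h) ω * ((SignType.sign (p - s) : ℝ) / 2))
      (fun s => fderiv ℝ f (s • ω + h) ω / 2) (Set.Iio p) := by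
    intro s hs
    have : 0 < p - s := sub_pos.2 hs
    simp [sign_pos this]; ring
  have c2 : Set.EqOn (fun s : ℝ => fderiv ℝ f (s • ω + h) ω * ((SignType.sign (p - s) : ℝ) / 2))
      (fun s => - fderiv ℝ f (s • ω + h) ω / 2) (Set.Ioi p) := by
    intro s hs
    have : p - s < 0 := sub_neg.2 hs
    simp [sign_neg this]; ring
  have k1 : IntegrableOn (fun s : ℝ => fderiv ℝ f (s • ω + h) ω / 2) (Set.Iic p) := by
    rw [integrableOn_Iic_iff_integrableOn_Iio]
    exact hi.integrableOn.congr_fun c1 measurableSet_Iio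
  have k2 : IntegrableOn (fun s : ℝ => - fderiv ℝ f (s • ω + h) ω / 2) (Set.Ioi p) := 
    hi.integrableOn.congr_fun c2 measurableSet_Ioi
  have e1 := integral_Iic_of_hasDerivAt_of_tendsto' (a := p) (fun s _ => (hu s).div_const 2) k1
    ((tend_line ω hω f h Filter.atBot Filter.tendsto_abs_atBot_atTop).div_const 2)
  have e2 := integral_Ioi_of_hasDerivAt_of_tendsto' (a := p) (fun s _ => (hu s).neg.div_const 2) k2
    ((tend_line ω hω f h Filter.atTop Filter.tendsto_abs_atTop_atTop).neg.div_const 2)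
  rw [integral_Iic_eq_integral_Iio, setIntegral_congr_fun measurableSet_Iio c1,
    setIntegral_congr_fun measurableSet_Ioi c2, ← integral_Iic_eq_integral_Iio, e1, e2]
  simp
  ring

theorem div_piece (ω : E) (hω : ‖ω‖ = 1) (f : SchwartzMap E ℝ) (e : E) (p : ℝ) :
    ∫ z, fderiv ℝ f z e * ((SignType.sign (p - ⟪z, ω⟫) : ℝ) / 2) =
      ⟪e, ω⟫ * ∫ h : (ℝ ∙ ω)ᗮ, f (p • ω + (h : E)) := by
  obtain ⟨⟨c, e'⟩, he⟩ := (spl ω hω).surjective e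
  rw [spl_apply] at he
  simp only at he
  have hIntg : ∀ v : E, Integrable (fun z => fderiv ℝ f z v * ((SignType.sign (p - ⟪z, ω⟫) : ℝ) / 2)) := by
    intro v
    simpa [SchwartzMap.fderivCLM_apply] using sign_int ω hω (SchwartzMap.evalCLM ℝ E ℝ v (SchwartzMap.fderivCLM ℝ E ℝ f)) p
  have t1 : ∫ z, fderiv ℝ f z e' * ((SignType.sign (p - ⟪z, ω⟫) : ℝ) / 2) = 0 := by
    rw [integral_split ω hω, integral_prod _ (integrable_split ω hω (hIntg e'))]
    simp only [inner_split ω hω, integral_mul_const, tang_zero ω hω f e']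
    simp
  have t2 : ∫ z, fderiv ℝ f z ω * ((SignType.sign (p - ⟪z, ω⟫) : ℝ) / 2) = ∫ h : (ℝ ∙ ω)ᗮ, f (p • ω + (h : E)) := by
    have hj := integrable_split ω hω (hIntg ω)
    rw [integral_split ω hω, integral_prod_symm _ hj]
    refine integral_congr_ae ?_
    filter_upwards [hj.prod_left_ae] with h hh
    simp only [inner_split ω hω] at hh ⊢
    exact line_int ω hω f h p hh
  have : ∀ z, fderiv ℝ f z e * ((SignType.sign (p - ⟪z, ω⟫) : ℝ) / 2) =
     c * (fderiv ℝ f z ω * ((SignType.sign (p - ⟪z, ω⟫) : ℝ) / 2)) + fderiv ℝ f z e' * ((SignType.sign (p - ⟪z, ω⟫) : ℝ) / 2) := by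
    intro z
    rw [← he]; simp; ring
  simp only [this]
  rw [integral_add ((hIntg ω).const_mul c) (hIntg e'), integral_const_mul, t1, t2, ← he, inner_split ω hω]
  ring

theorem fub (hd : 3 ≤ Module.finrank ℝ E) (ω : E) (hω : ‖ω‖ = 1) (f : SchwartzMap E ℝ) (p : ℝ) :
    Integrable (fun h : (ℝ ∙ ω)ᗮ => ∫ y, f (p • ω + (h : E) - y) * KK ω y) ∧
    ∫ h : (ℝ ∙ ω)ᗮ, ∫ y, f (p • ω + (h : E) - y) * KK ω y =
      ∫ z, f z * ((SignType.sign (p - ⟪z, ω⟫) : ℝ) / 2) := by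
  have hch : ∀ x : E, ∫ y, f (x - y) * KK ω y = ∫ z, f z * KK ω (x - z) := by
    intro x
    rw [← integral_sub_left_eq_self _ volume x]
    simp
  simp only [hch]
  -- slice
  have hsl : ∀ z : E, Integrable (fun h : (ℝ ∙ ω)ᗮ => KK ω (p • ω + (h : E) - z)) ∧
      ∫ h : (ℝ ∙ ω)ᗮ, KK ω (p • ω + (h : E) - z) = (SignType.sign (p - ⟪z, ω⟫) : ℝ) / 2 ∧
      ∫ h : (ℝ ∙ ω)ᗮ, ‖KK ω (p • ω + (h : E) - z)‖ ≤ 1 / 2 := by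
    intro z
    obtain ⟨⟨s, h'⟩, he⟩ := (spl ω hω).surjective z
    rw [spl_apply] at he
    simp only at he
    have hr : ∀ h : (ℝ ∙ ω)ᗮ, p • ω + (h : E) - z = (p - s) • ω + ((h - h' : (ℝ ∙ ω)ᗮ) : E) := by
      intro h
      rw [← he, sub_smul]; push_cast; abel
    have hin : ⟪z, ω⟫ = s := by rw [← he, inner_split ω hω]
    obtain ⟨a1, a2, a3⟩ := KK_int ω hω (p - s)
    simp only [hr, hin]
    refine ⟨a1.comp_sub_right h', ?_, ?_⟩
    · rw [integral_sub_right_eq_self (fun h : (ℝ ∙ ω)ᗮ => KK ω ((p - s) • ω + (h : E))) h', a2]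
    · rw [integral_sub_right_eq_self (fun h : (ℝ ∙ ω)ᗮ => ‖KK ω ((p - s) • ω + (h : E))‖) h']
      exact a3
  have hfc := f.continuous
  have hKm := KK_meas ω
  have hA : Integrable (fun w : (ℝ ∙ ω)ᗮ × E => f w.2 * KK ω (p • ω + (w.1 : E) - w.2)) (volume.prod volume) := by
    have hm : Measurable (fun w : (ℝ ∙ ω)ᗮ × E => f w.2 * KK ω (p • ω + (w.1 : E) - w.2)) := by
      fun_prop
    rw [integrable_prod_iff' hm.aestronglyMeasurable]
    refine ⟨Filter.Eventually.of_forall fun z => (hsl z).1.const_mul (f z), ?_⟩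
    refine (f.integrable (μ := volume)).norm.mono' ?_ (Filter.Eventually.of_forall fun z => ?_)
    · exact (hm.norm.aestronglyMeasurable.prod_swap).integral_prod_right'
    · simp only [norm_mul]
      rw [integral_const_mul, norm_mul, norm_norm, norm_of_nonneg (integral_nonneg fun _ => norm_nonneg _)]
      nlinarith [(hsl z).2.2, norm_nonneg (f z)]
  refine ⟨hA.integral_prod_left, ?_⟩
  rw [integral_integral_swap (f := fun (h : (ℝ ∙ ω)ᗮ) z => f z * KK ω (p • ω + (h : E) - z)) hA]
  congr 1; ext z
  rw [integral_const_mul, (hsl z).2.1]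

theorem phi_int (hd : 3 ≤ Module.finrank ℝ E) (f : SchwartzMap E ℝ) (c : ℝ) (x : E) :
    Integrable (fun y => (c * ‖y‖ ^ (2 - (Module.finrank ℝ E : ℝ))) • fderiv ℝ f (x - y)) := by
  obtain ⟨b, hbi, hbb⟩ := weight_bound hd (2 - (Module.finrank ℝ E : ℝ)) (by linarith) le_rfl
    (SchwartzMap.fderivCLM ℝ E ℝ f) x
  refine (hbi.const_mul |c|).mono' ?_ (Filter.Eventually.of_forall fun y => ?_)
  · have : Continuous (fun y => fderiv ℝ f (x - y)) := by
      have := (SchwartzMap.fderivCLM ℝ E ℝ f).continuous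
      exact this.comp (by fun_prop : Continuous fun y => x - y)
    have hm : AEStronglyMeasurable (fun y : E => c * ‖y‖ ^ (2 - (Module.finrank ℝ E : ℝ))) volume :=
      Measurable.aestronglyMeasurable (by fun_prop)
    exact hm.smul this.aestronglyMeasurable
  · rw [norm_smul, norm_eq_abs, abs_mul, abs_of_nonneg (a := ‖y‖ ^ _) (by positivity), mul_assoc,
      mul_comm (‖y‖ ^ _)]
    gcongr
    exact hbb x (by simp) y

end R17d

/-- the transversal Radon transform of `F` equals that of its potential part
`F^p = ∇φ`, both being well defined. -/
theorem stmt17 (d : ℕ) (hd : 3 ≤ d)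
    (F : EuclideanSpace ℝ (Fin d) → EuclideanSpace ℝ (Fin d))
    (hF : ∀ j : Fin d, IsSchwartz (fun x => ⟪canE d j, F x⟫))
    (Φ : EuclideanSpace ℝ (Fin d) → ℝ) (hΦ : ∀ x, Φ x = vdiv F x)
    (φ : EuclideanSpace ℝ (Fin d) → ℝ)
    (hφ : ∀ x, φ x = ∫ y, Φ y * fundSol d (x - y)) :
    ∀ ω : EuclideanSpace ℝ (Fin d), ‖ω‖ = 1 → ∀ p : ℝ,
      Integrable
        (fun y : ((ℝ ∙ ω)ᗮ : Submodule ℝ (EuclideanSpace ℝ (Fin d))) =>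
          ⟪ω, F (p • ω + (y : EuclideanSpace ℝ (Fin d)))⟫) volume ∧
      Integrable
        (fun y : ((ℝ ∙ ω)ᗮ : Submodule ℝ (EuclideanSpace ℝ (Fin d))) =>
          ⟪ω, gradient φ (p • ω + (y : EuclideanSpace ℝ (Fin d)))⟫) volume ∧
      Dperp F ω p = Dperp (fun x => gradient φ x) ω p := by
  intro ω hω p
  choose g hg using hF
  have hfr : Module.finrank ℝ (EuclideanSpace ℝ (Fin d)) = d := by simp
  have hd' : 3 ≤ Module.finrank ℝ (EuclideanSpace ℝ (Fin d)) := by rw [hfr]; exact hd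
  have hgf : ∀ j, (fun y => ⟪canE d j, F y⟫) = g j := fun j => funext (hg j)
  -- the divergence as a Schwartz function
  let f : SchwartzMap (EuclideanSpace ℝ (Fin d)) ℝ :=
    ∑ j, SchwartzMap.evalCLM ℝ _ ℝ (canE d j) (SchwartzMap.fderivCLM ℝ _ ℝ (g j))
  have hf : ∀ x, f x = ∑ j, fderiv ℝ (g j) x (canE d j) := by
    intro x
    simp [f, SchwartzMap.sum_apply, SchwartzMap.fderivCLM_apply]
  have hΦf : ∀ x, Φ x = f x := by
    intro x
    rw [hΦ, hf, vdiv]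
    simp only [hgf]
  have hφf : φ = fun x => ∫ y, f (x - y) *
      (-(Gamma ((Module.finrank ℝ (EuclideanSpace ℝ (Fin d)) : ℝ) / 2 - 1) /
        (4 * π ^ ((Module.finrank ℝ (EuclideanSpace ℝ (Fin d)) : ℝ) / 2))) *
        ‖y‖ ^ (2 - (Module.finrank ℝ (EuclideanSpace ℝ (Fin d)) : ℝ))) := by
    ext x
    rw [hφ, ← integral_sub_left_eq_self _ volume x]
    simp only [hΦf, fundSol, sub_sub_cancel, hfr]
  have hgrad : ∀ x, ⟪ω, gradient φ x⟫ = ∫ y, f (x - y) * KK ω y := by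
    intro x
    have h1 := phi_deriv hd' f (-(Gamma ((Module.finrank ℝ (EuclideanSpace ℝ (Fin d)) : ℝ) / 2 - 1) /
        (4 * π ^ ((Module.finrank ℝ (EuclideanSpace ℝ (Fin d)) : ℝ) / 2)))) x
    rw [← hφf] at h1
    rw [real_inner_comm, gradient, InnerProductSpace.toDual_symm_apply, h1.fderiv, ← ibp hd' ω hω f x,
      ContinuousLinearMap.integral_apply]
    · simp
    · exact phi_int hd' f _ x
  have hωF : ∀ x, ⟪ω, F x⟫ = ∑ j, ⟪canE d j, ω⟫ * g j x := by
    intro x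
    simp only [← hg]
    simp [canE, PiLp.inner_apply, EuclideanSpace.inner_single_left, mul_comm]
  obtain ⟨b1, b2⟩ := fub hd' ω hω f p
  have hgi : ∀ j, Integrable (fun h : ((ℝ ∙ ω)ᗮ : Submodule ℝ (EuclideanSpace ℝ (Fin d))) =>
      ⟪canE d j, ω⟫ * g j (p • ω + (h : EuclideanSpace ℝ (Fin d)))) :=
    fun j => (integrable_H ω hω (g j) p).const_mul _
  refine ⟨?_, ?_, ?_⟩
  · simp only [hωF]
    exact integrable_finset_sum _ fun j _ => hgi j
  · simp only [hgrad]
    exact b1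
  · unfold Dperp RadonT
    simp only [hgrad, hωF]
    rw [b2, integral_finset_sum _ fun j _ => hgi j]
    simp only [hf, Finset.sum_mul]
    rw [integral_finset_sum]
    · refine Finset.sum_congr rfl fun j _ => ?_
      rw [integral_const_mul, div_piece ω hω (g j) (canE d j) p]
    · intro j _
      simpa [SchwartzMap.fderivCLM_apply] using sign_int ω hω
        (SchwartzMap.evalCLM ℝ _ ℝ (canE d j) (SchwartzMap.fderivCLM ℝ _ ℝ (g j))) p
end
end
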